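/- Let X and Y be cocompact G-trees that define the same partition of G into elliptic and hyperbolic elements. Suppose further that X is reduced and every vertex stabilizer of X fixes a vertex of Y. Then, after possibly subdividing X (inserting vertices in the interiors of edges, equivariantly), there is a G-equivariant morphism φ : X' → Y, where X' is the subdivided tree. -/

import Mathlib

universe u

/-- A `G`-tree: a simplicial tree together with an action of `G` by graph
automorphisms without inversions. -/
structure GTree (G : Type u) [Group G] : Type (u + 1) where
  V : Type u
  graph : SimpleGraph V
  isTree : graph.IsTree
  smul : G → V → V
  smul_one : ∀ x, smul 1 x = x
  smul_mul : ∀ γ δ x, smul (γ * δ) x = smul γ (smul δ x)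
  smul_adj : ∀ (γ : G) ⦃x y : V⦄, graph.Adj x y → graph.Adj (smul γ x) (smul γ y)
  no_inversions : ∀ (γ : G) (x y : V), graph.Adj x y → ¬(smul γ x = y ∧ smul γ y = x)

namespace GTree

variable {G : Type u} [Group G]

/-- Oriented edges of a `G`-tree. -/
def Edge (X : GTree G) : Type u := { p : X.V × X.V // X.graph.Adj p.1 p.2 }

/-- Initial vertex `∂₀ e` of an oriented edge. -/
def d0 {X : GTree G} (e : X.Edge) : X.V := e.1.1

/-- Terminal vertex `∂₁ e` of an oriented edge. -/
def d1 {X : GTree G} (e : X.Edge) : X.V := e.1.2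

/-- The underlying geometric (unoriented) edge. -/
def esym {X : GTree G} (e : X.Edge) : Sym2 X.V := s(e.1.1, e.1.2)

/-- Action of `G` on oriented edges. -/
def edgeSmul {X : GTree G} (γ : G) (e : X.Edge) : X.Edge :=
  ⟨(X.smul γ e.1.1, X.smul γ e.1.2), X.smul_adj γ e.2⟩

/-- Vertex stabilizer `G_x`. -/
def stab (X : GTree G) (x : X.V) : Subgroup G where
  carrier := { γ | X.smul γ x = x }
  one_mem' := X.smul_one x
  mul_mem' := by
    intro a b ha hb
    simp only [Set.mem_setOf_eq] at *
    rw [X.smul_mul, hb, ha]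
  inv_mem' := by
    intro a ha
    simp only [Set.mem_setOf_eq] at *
    conv_lhs => rw [← ha]
    rw [← X.smul_mul, inv_mul_cancel, X.smul_one]

/-- Edge stabilizer `G_e`: the elements fixing both endpoints (since the action
is without inversions, these are exactly the elements fixing the edge). -/
def edgeStab (X : GTree G) (e : X.Edge) : Subgroup G :=
  X.stab (d0 e) ⊓ X.stab (d1 e)

/-- An element of `G` is elliptic if it fixes a vertex. -/
def Elliptic (X : GTree G) (γ : G) : Prop := ∃ x, X.smul γ x = x

/-- A subgroup of `G` is elliptic if it fixes a vertex. -/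
def FixesVertex (X : GTree G) (H : Subgroup G) : Prop := ∃ x, ∀ γ ∈ H, X.smul γ x = x

/-- Two `G`-trees have the same elliptic subgroups. -/
def SameEllipticSubgroups (X Y : GTree G) : Prop :=
  ∀ H : Subgroup G, X.FixesVertex H ↔ Y.FixesVertex H

/-- The length function `ℓ_X(γ)`: the minimal vertex displacement. -/
noncomputable def transLen (X : GTree G) (γ : G) : ℕ :=
  sInf (Set.range fun x => X.graph.dist x (X.smul γ x))

/-- Cocompact: the quotient graph `G\X` is finite, i.e. there are finitely
many orbits of vertices and of edges. -/
def Cocompact (X : GTree G) : Prop :=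
  Finite (Quot fun x y : X.V => ∃ γ, X.smul γ x = y) ∧
    Finite (Quot fun e f : X.Edge => ∃ γ, edgeSmul γ e = f)

/-- Reduced: whenever `G_e = G_{∂₀ e}`, the endpoints of `e` are in the same
`G`-orbit. -/
def Reduced (X : GTree G) : Prop :=
  ∀ e : X.Edge, X.edgeStab e = X.stab (d0 e) → ∃ γ, X.smul γ (d0 e) = d1 e

/-- A nonempty `G`-invariant subtree (a nonempty invariant set of vertices that
is connected in the induced graph). -/
def IsInvariantSubtree (X : GTree G) (S : Set X.V) : Prop :=
  S.Nonempty ∧ (∀ γ, ∀ x ∈ S, X.smul γ x ∈ S) ∧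
    ∀ x ∈ S, ∀ y ∈ S, ∃ p : X.graph.Walk x y, ∀ v ∈ p.support, v ∈ S

/-- Minimal: there is no proper nonempty invariant subtree. -/
def Minimal (X : GTree G) : Prop :=
  ∀ S : Set X.V, X.IsInvariantSubtree S → S = Set.univ

/-- Strongly slide-free: minimal, and for all edges `e`, `f` with
`∂₀ e = ∂₀ f`, the inclusion `G_e ⊆ G_f` implies `f ∈ G e`. -/
def StronglySlideFree (X : GTree G) : Prop :=
  X.Minimal ∧ ∀ e f : X.Edge, d0 e = d0 f → X.edgeStab e ≤ X.edgeStab f →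
    ∃ γ, edgeSmul γ e = f

/-- Proper: `G_e ⊊ G_{∂₀ e}` for every edge `e`. -/
def Proper (X : GTree G) : Prop := ∀ e : X.Edge, X.edgeStab e < X.stab (d0 e)

/-- Locally finite: every vertex has finite valence. -/
def LocallyFinite (X : GTree G) : Prop := ∀ x : X.V, (X.graph.neighborSet x).Finite

/-- `φ` is an isomorphism of `G`-trees: an equivariant graph isomorphism. -/
def IsGIso (X Y : GTree G) (φ : X.V → Y.V) : Prop :=
  Function.Bijective φ ∧ (∀ x y, X.graph.Adj x y ↔ Y.graph.Adj (φ x) (φ y)) ∧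
    ∀ γ x, φ (X.smul γ x) = Y.smul γ (φ x)

/-- `φ : X → Y` is the collapse move performed at (the orbit of) the edge `e`:
`G_e = G_{∂₀ e}`, the endpoints of `e` lie in different `G`-orbits, and `Y` is
the equivariant quotient of `X` identifying `∂₀(γ e)` with `∂₁(γ e)` for all
`γ ∈ G`. -/
def IsCollapse (X Y : GTree G) (φ : X.V → Y.V) (e : X.Edge) : Prop :=
  X.edgeStab e = X.stab (d0 e) ∧
  (∀ γ : G, X.smul γ (d0 e) ≠ d1 e) ∧
  Function.Surjective φ ∧
  (∀ γ x, φ (X.smul γ x) = Y.smul γ (φ x)) ∧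
  (∀ u v : X.V, φ u = φ v ↔
    Relation.EqvGen (fun a b => ∃ γ : G, a = X.smul γ (d0 e) ∧ b = X.smul γ (d1 e)) u v) ∧
  (∀ a b : Y.V, a ≠ b → (Y.graph.Adj a b ↔ ∃ u v, X.graph.Adj u v ∧ φ u = a ∧ φ v = b))

/-- `Y` is obtained from `X` by a collapse move. -/
def Collapse (X Y : GTree G) : Prop := ∃ (φ : X.V → Y.V) (e : X.Edge), IsCollapse X Y φ e

/-- Elementary deformation: a finite composition of collapse moves and their
inverses (expansion moves). -/
def ElemDeformation : GTree G → GTree G → Prop := Relation.EqvGen Collapse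

end GTree

namespace GTree

variable {G : Type u} [Group G]

/-- `X'` is an (equivariant) subdivision of `X`: there is an injective
equivariant map `ι : V(X) → V(X')` such that each edge of `X` corresponds to a
nontrivial path in `X'` whose interior vertices avoid the image of `ι`, and
every vertex of `X'` outside the image of `ι` is an interior vertex of such a
path. -/
def IsSubdivisionOf (X' X : GTree G) : Prop :=
  ∃ ι : X.V → X'.V, Function.Injective ι ∧
    (∀ γ x, ι (X.smul γ x) = X'.smul γ (ι x)) ∧
    (∀ x y : X.V, X.graph.Adj x y →
      ∃ p : X'.graph.Walk (ι x) (ι y), p.IsPath ∧ 0 < p.length ∧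
        ∀ v ∈ p.support, v ≠ ι x → v ≠ ι y → v ∉ Set.range ι) ∧
    (∀ v : X'.V, v ∉ Set.range ι → ∃ x y : X.V, X.graph.Adj x y ∧
      ∃ p : X'.graph.Walk (ι x) (ι y), p.IsPath ∧ v ∈ p.support ∧
        ∀ w ∈ p.support, w ≠ ι x → w ≠ ι y → w ∉ Set.range ι)

end GTree

namespace SimpleGraph

variable {V : Type*} {T : SimpleGraph V}

/-- In a tree, a vertex has at most one neighbour closer to a given root. -/
lemma IsTree.eq_of_adj_of_dist_lt (hT : T.IsTree) {r a b c : V} (ha : T.Adj c a) (hb : T.Adj c b)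
    (hra : T.dist r a < T.dist r c) (hrb : T.dist r b < T.dist r c) : a = b := by
  have key : ∀ {d : V} (hd : T.Adj c d), T.dist r d < T.dist r c →
      ∃ p : T.Walk d r, (Walk.cons hd p).IsPath := by
    intro d hd hlt
    obtain ⟨p, hp⟩ := hT.connected.exists_walk_length_eq_dist d r
    refine ⟨p, Walk.isPath_of_length_eq_dist _ ?_⟩
    have h := hT.dist_eq_dist_add_one_of_adj r hd
    rw [Walk.length_cons, hp, dist_comm, dist_comm (u := c)]
    omega
  obtain ⟨p, hp⟩ := key ha hra
  obtain ⟨q, hq⟩ := key hb hrb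
  have h := congrArg Subtype.val ((hT.isAcyclic.subsingleton_path c r).elim ⟨_, hp⟩ ⟨_, hq⟩)
  simpa using congrArg Walk.snd h

/-- A graph is acyclic if its vertices can be ranked so that every vertex has at most one
neighbour of no larger rank. -/
lemma isAcyclic_of_rank {α : Type*} [LinearOrder α] (rank : V → α)
    (h : ∀ p a b, T.Adj p a → T.Adj p b → rank a ≤ rank p → rank b ≤ rank p → a = b) :
    T.IsAcyclic := by
  classical
  intro v c hc
  obtain ⟨m, hm, hmax⟩ := c.support.toFinset.exists_max_image rank ⟨v, by simp⟩
  rw [List.mem_toFinset] at hm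
  have hc' := hc.rotate hm
  have hle : ∀ w ∈ (c.rotate m hm).support, rank w ≤ rank m := fun w hw ↦
    hmax w (by simpa [Walk.mem_support_rotate_iff] using hw)
  exact hc'.snd_ne_penultimate <| h m _ _ (Walk.adj_snd hc'.not_nil)
    (Walk.adj_penultimate hc'.not_nil).symm (hle _ (Walk.getVert_mem_support _ _))
    (hle _ (Walk.getVert_mem_support _ _))

end SimpleGraph

namespace GTree

variable {G : Type u} [Group G]

lemma smul_inv_smul (X : GTree G) (γ : G) (x : X.V) : X.smul γ (X.smul γ⁻¹ x) = x := by
  rw [← X.smul_mul, mul_inv_cancel, X.smul_one]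

lemma inv_smul_smul (X : GTree G) (γ : G) (x : X.V) : X.smul γ⁻¹ (X.smul γ x) = x := by
  rw [← X.smul_mul, inv_mul_cancel, X.smul_one]

lemma smul_injective (X : GTree G) (γ : G) : Function.Injective (X.smul γ) :=
  Function.LeftInverse.injective (X.inv_smul_smul γ)

lemma dist_smul_le (X : GTree G) (γ : G) (x y : X.V) :
    X.graph.dist (X.smul γ x) (X.smul γ y) ≤ X.graph.dist x y := by
  obtain ⟨p, hp⟩ := X.isTree.connected.exists_walk_length_eq_dist x y
  let F : X.graph →g X.graph := ⟨X.smul γ, fun h ↦ X.smul_adj γ h⟩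
  rw [← hp, ← p.length_map F]
  exact SimpleGraph.dist_le _

lemma dist_smul (X : GTree G) (γ : G) (x y : X.V) :
    X.graph.dist (X.smul γ x) (X.smul γ y) = X.graph.dist x y := by
  refine (X.dist_smul_le γ x y).antisymm ?_
  simpa only [inv_smul_smul] using X.dist_smul_le γ⁻¹ (X.smul γ x) (X.smul γ y)

lemma not_elliptic_of_adj_smul (X : GTree G) {γ : G} {x : X.V}
    (h : X.graph.Adj x (X.smul γ x)) : ¬ X.Elliptic γ := by
  rintro ⟨z, hz⟩
  apply X.isTree.dist_ne_of_adj z h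
  conv_rhs => rw [← hz]
  rw [dist_smul]

/-- If `a` and `b` fix opposite endpoints of an edge and neither fixes the edge, then `a * b` is
hyperbolic. -/
lemma not_elliptic_mul (X : GTree G) {a b : G} {x y : X.V} (h : X.graph.Adj x y)
    (hax : X.smul a x = x) (hay : X.smul a y ≠ y) (hby : X.smul b y = y) (hbx : X.smul b x ≠ x) :
    ¬ X.Elliptic (a * b) := by
  rintro ⟨z, hz⟩
  have hdist : ∀ w, X.graph.dist z (X.smul (a * b) w) = X.graph.dist z w := by
    intro w
    conv_lhs => rw [← hz]
    rw [dist_smul]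
  have hgy : X.smul (a * b) y = X.smul a y := by rw [X.smul_mul, hby]
  have hdy := hdist y
  have hdx := hdist x
  have h1 : X.graph.Adj x (X.smul (a * b) y) := by
    rw [hgy]
    simpa [hax] using X.smul_adj a h
  have h2 : X.graph.Adj (X.smul (a * b) y) (X.smul (a * b) x) := (X.smul_adj _ h).symm
  rcases X.isTree.dist_eq_dist_add_one_of_adj z h with hxy | hxy
  · have := X.isTree.eq_of_adj_of_dist_lt (r := z) h h1 (by omega) (by omega)
    exact hay (hgy.symm.trans this.symm)
  · have := X.isTree.eq_of_adj_of_dist_lt (r := z) h1.symm h2 (by omega) (by omega)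
    apply hbx
    apply X.smul_injective a
    rw [← X.smul_mul, ← this, hax]

/-- A choice, for every vertex `x` of `X`, of a vertex of `Y` fixed by the stabilizer of `x` can be
made equivariantly. -/
lemma exists_equivariant_map (X Y : GTree G)
    (hstab : ∀ x : X.V, ∃ y : Y.V, ∀ γ : G, X.smul γ x = x → Y.smul γ y = y) :
    ∃ f : X.V → Y.V, ∀ γ x, f (X.smul γ x) = Y.smul γ (f x) := by
  choose c hc using hstab
  let S : Setoid X.V :=
    { r := fun x y ↦ ∃ γ, X.smul γ x = y
      iseqv :=
        { refl := fun x ↦ ⟨1, X.smul_one x⟩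
          symm := by
            rintro x y ⟨γ, rfl⟩
            exact ⟨γ⁻¹, X.inv_smul_smul γ x⟩
          trans := by
            rintro x y z ⟨γ, rfl⟩ ⟨δ, rfl⟩
            exact ⟨δ * γ, X.smul_mul δ γ x⟩ } }
  let rep : X.V → X.V := fun x ↦ (Quotient.mk S x).out
  have hrep : ∀ x, ∃ γ, X.smul γ (rep x) = x := fun x ↦ Quotient.mk_out (s := S) x
  have hrep_smul : ∀ γ x, rep (X.smul γ x) = rep x := fun γ x ↦
    congrArg Quotient.out (Quotient.sound (s := S) ⟨γ⁻¹, X.inv_smul_smul γ x⟩)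
  choose g hg using hrep
  refine ⟨fun x ↦ Y.smul (g x) (c (rep x)), fun γ x ↦ ?_⟩
  have hfix : X.smul ((g (X.smul γ x))⁻¹ * (γ * g x)) (rep x) = rep x := by
    rw [X.smul_mul, X.smul_mul, hg]
    have := congrArg (X.smul (g (X.smul γ x))⁻¹) (hg (X.smul γ x))
    rw [inv_smul_smul, hrep_smul] at this
    exact this.symm
  have := congrArg (Y.smul (g (X.smul γ x))) (hc _ _ hfix)
  rw [Y.smul_mul, smul_inv_smul, Y.smul_mul] at this
  simp only [hrep_smul]
  exact this.symm

/-- An equivariant map from a reduced tree to a tree with the same elliptic elements separates the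
endpoints of every edge. -/
lemma ne_of_adj_of_equivariant (X Y : GTree G) (hpart : ∀ γ : G, X.Elliptic γ ↔ Y.Elliptic γ)
    (hred : X.Reduced) {f : X.V → Y.V} (hf : ∀ γ x, f (X.smul γ x) = Y.smul γ (f x))
    {x y : X.V} (h : X.graph.Adj x y) : f x ≠ f y := by
  intro hxy
  have horb : ∀ {x y : X.V}, X.graph.Adj x y → f x = f y → ∀ γ, X.smul γ x ≠ y := by
    rintro x _ h hxy γ rfl
    exact X.not_elliptic_of_adj_smul h ((hpart γ).2 ⟨f x, by rw [← hf, ← hxy]⟩)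
  have hstab : ∀ {x y : X.V}, X.graph.Adj x y → f x = f y →
      ∃ a, X.smul a x = x ∧ X.smul a y ≠ y := by
    intro x y h hxy
    by_contra! hcon
    obtain ⟨γ, hγ⟩ := hred ⟨(x, y), h⟩ (inf_eq_left.2 fun a ha ↦ hcon a ha)
    exact horb h hxy γ hγ
  obtain ⟨a, hax, hay⟩ := hstab h hxy
  obtain ⟨b, hby, hbx⟩ := hstab h.symm hxy.symm
  refine X.not_elliptic_mul h hax hay hby hbx ((hpart _).2 ⟨f x, ?_⟩)
  rw [Y.smul_mul, hxy, ← hf b, hby, ← hxy, ← hf a, hax]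

section Subdivision

variable {X Y : GTree G} (f : X.V → Y.V)

/-- The points of the edge `{x, y}` subdivided along the geodesic from `f x` to `f y`. A vertex `x`
of `X` is encoded as `(s(x, x), f x)` and an interior point as the edge containing it together with
its position on the geodesic. -/
def InSegment (x y : X.V) (p : Sym2 X.V × Y.V) : Prop :=
  p = (s(x, x), f x) ∨ p = (s(y, y), f y) ∨
    (p.1 = s(x, y) ∧ p.2 ≠ f x ∧ p.2 ≠ f y ∧
      Y.graph.dist (f x) p.2 + Y.graph.dist p.2 (f y) = Y.graph.dist (f x) (f y))

/-- The vertices of the subdivision of `X` along `f`. -/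
def SubdivVertex : Type u :=
  { p : Sym2 X.V × Y.V //
    (∃ x, p = (s(x, x), f x)) ∨ ∃ x y, X.graph.Adj x y ∧ InSegment f x y p }

/-- The subdivision of the graph of `X` along `f`. -/
def subdivGraph : SimpleGraph (SubdivVertex f) where
  Adj p q := Y.graph.Adj p.1.2 q.1.2 ∧
    ∃ x y, X.graph.Adj x y ∧ InSegment f x y p.1 ∧ InSegment f x y q.1
  symm := ⟨fun _ _ ⟨h, x, y, hxy, hp, hq⟩ ↦ ⟨h.symm, x, y, hxy, hq, hp⟩⟩
  loopless := ⟨fun _ h ↦ h.1.ne rfl⟩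

/-- The inclusion of the vertices of `X` into those of its subdivision. -/
def toSubdiv (x : X.V) : SubdivVertex f := ⟨(s(x, x), f x), .inl ⟨x, rfl⟩⟩

/-- The map from the subdivision to `Y` is a graph homomorphism. -/
def subdivHom : subdivGraph f →g Y.graph := ⟨fun p ↦ p.1.2, fun h ↦ h.1⟩

variable {f}

lemma toSubdiv_injective : Function.Injective (toSubdiv f) := by
  intro x y h
  have := congrArg (fun p : SubdivVertex f ↦ p.1.1) h
  simpa [toSubdiv] using this

lemma InSegment.symm {x y : X.V} {p : Sym2 X.V × Y.V} (h : InSegment f x y p) :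
    InSegment f y x p := by
  rcases h with h | h | ⟨h, hx, hy, hd⟩
  · exact .inr (.inl h)
  · exact .inl h
  · refine .inr (.inr ⟨h.trans Sym2.eq_swap, hy, hx, ?_⟩)
    rw [Y.graph.dist_comm, add_comm, Y.graph.dist_comm, hd, Y.graph.dist_comm]

lemma inSegment_left (x y : X.V) : InSegment f x y (toSubdiv f x).1 := .inl rfl

lemma inSegment_right (x y : X.V) : InSegment f x y (toSubdiv f y).1 := .inr (.inl rfl)

lemma InSegment.dist_add_dist {x y : X.V} {p : Sym2 X.V × Y.V} (h : InSegment f x y p) :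
    Y.graph.dist (f x) p.2 + Y.graph.dist p.2 (f y) = Y.graph.dist (f x) (f y) := by
  rcases h with rfl | rfl | h
  · simp
  · simp
  · exact h.2.2.2

/-- Points of a segment are determined by their image in `Y`. -/
lemma InSegment.ext {x y : X.V} (hxy : f x ≠ f y) {p q : Sym2 X.V × Y.V}
    (hp : InSegment f x y p) (hq : InSegment f x y q) (h : p.2 = q.2) : p = q := by
  rcases hp with rfl | rfl | ⟨hp, hpx, hpy, -⟩ <;> rcases hq with rfl | rfl | ⟨hq, hqx, hqy, -⟩ <;>
    simp_all [Prod.ext_iff]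

lemma InSegment.eq_toSubdiv {x y : X.V} (hxy : X.graph.Adj x y) {p : SubdivVertex f}
    (hp : InSegment f x y p.1) {z : X.V} (hz : p = toSubdiv f z) : z = x ∨ z = y := by
  have hz' : p.1 = (s(z, z), f z) := congrArg Subtype.val hz
  rw [hz'] at hp
  have := hxy.ne
  rcases hp with h | h | h
  · simp_all
  · simp_all
  · have h1 := h.1
    simp only [Sym2.eq_iff] at h1
    grind

/-- Every vertex on the geodesic from `f x` to `f y` comes from a point of the segment. -/
lemma exists_inSegment {x y : X.V} (hxy : X.graph.Adj x y) {v : Y.V}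
    (hv : Y.graph.dist (f x) v + Y.graph.dist v (f y) = Y.graph.dist (f x) (f y)) :
    ∃ p : SubdivVertex f, InSegment f x y p.1 ∧ p.1.2 = v := by
  by_cases hx : v = f x
  · exact ⟨toSubdiv f x, inSegment_left x y, hx.symm⟩
  by_cases hy : v = f y
  · exact ⟨toSubdiv f y, inSegment_right x y, hy.symm⟩
  have h : InSegment f x y (s(x, y), v) := .inr (.inr ⟨rfl, hx, hy, hv⟩)
  exact ⟨⟨_, .inr ⟨x, y, hxy, h⟩⟩, h, rfl⟩

/-- A point of a segment is joined to the left endpoint by a walk in the segment. -/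
lemma InSegment.exists_walk {x y : X.V} (hxy : X.graph.Adj x y) (hne : f x ≠ f y)
    (p : SubdivVertex f) (hp : InSegment f x y p.1) :
    ∃ w : (subdivGraph f).Walk (toSubdiv f x) p,
      w.length = Y.graph.dist (f x) p.1.2 ∧ ∀ q ∈ w.support, InSegment f x y q.1 := by
  induction hn : Y.graph.dist (f x) p.1.2 generalizing p with
  | zero =>
    have h : f x = p.1.2 := Y.isTree.connected.dist_eq_zero_iff.1 hn
    obtain rfl : toSubdiv f x = p := Subtype.ext ((inSegment_left x y).ext hne hp h)
    exact ⟨.nil, rfl, by simpa using hp⟩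
  | succ n ih =>
    obtain ⟨w, hw⟩ := Y.isTree.connected.exists_walk_length_eq_dist p.1.2 (f x)
    rw [Y.graph.dist_comm, hn] at hw
    have hnil : ¬ w.Nil := by
      rw [← SimpleGraph.Walk.length_eq_zero_iff]
      omega
    obtain ⟨v, hv, hle⟩ : ∃ v, Y.graph.Adj p.1.2 v ∧ Y.graph.dist (f x) v ≤ n := by
      refine ⟨w.snd, w.adj_snd hnil, ?_⟩
      rw [Y.graph.dist_comm]
      have := w.length_tail_add_one hnil
      exact (SimpleGraph.dist_le w.tail).trans (by omega)
    have h1 := Y.isTree.dist_eq_dist_add_one_of_adj (f x) hv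
    have h2 := Y.isTree.dist_eq_dist_add_one_of_adj (f y) hv
    have h3 := hp.dist_add_dist
    have h4 := Y.isTree.connected.dist_triangle (u := f x) (v := v) (w := f y)
    rw [Y.graph.dist_comm (u := f y), Y.graph.dist_comm (u := f y)] at h2
    obtain ⟨q, hq, rfl⟩ := exists_inSegment (f := f) hxy (v := v) (by omega)
    obtain ⟨u, hu, hus⟩ := ih q hq (by omega)
    have hadj : (subdivGraph f).Adj q p := ⟨hv.symm, x, y, hxy, hq, hp⟩
    refine ⟨u.concat hadj, by rw [SimpleGraph.Walk.length_concat, hu], ?_⟩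
    intro r hr
    rw [SimpleGraph.Walk.support_concat, List.mem_append,
      List.mem_singleton] at hr
    rcases hr with hr | rfl
    · exact hus r hr
    · exact hp

/-- A point of a segment lies on a path in the segment joining its endpoints. -/
lemma InSegment.exists_path {x y : X.V} (hxy : X.graph.Adj x y) (hne : f x ≠ f y)
    {p : SubdivVertex f} (hp : InSegment f x y p.1) :
    ∃ w : (subdivGraph f).Walk (toSubdiv f x) (toSubdiv f y),
      w.IsPath ∧ p ∈ w.support ∧ ∀ q ∈ w.support, InSegment f x y q.1 := by
  obtain ⟨w₁, hl₁, hs₁⟩ := hp.exists_walk hxy hne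
  obtain ⟨w₂, hl₂, hs₂⟩ := hp.symm.exists_walk hxy.symm hne.symm
  refine ⟨w₁.append w₂.reverse, SimpleGraph.Walk.isPath_of_length_eq_dist _ ?_, by simp, ?_⟩
  · refine le_antisymm ?_ (SimpleGraph.dist_le _)
    obtain ⟨w, hw⟩ :=
      (w₁.append w₂.reverse).reachable.exists_walk_length_eq_dist
    rw [← hw, ← w.length_map (subdivHom f), SimpleGraph.Walk.length_append,
      SimpleGraph.Walk.length_reverse, hl₁, hl₂, Y.graph.dist_comm (u := f y), hp.dist_add_dist]
    exact SimpleGraph.dist_le _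
  · intro q hq
    rw [SimpleGraph.Walk.mem_support_append_iff, SimpleGraph.Walk.support_reverse,
      List.mem_reverse] at hq
    rcases hq with hq | hq
    · exact hs₁ q hq
    · exact (hs₂ q hq).symm

lemma subdivGraph_connected (hne : ∀ x y, X.graph.Adj x y → f x ≠ f y) :
    (subdivGraph f).Connected := by
  have hX : ∀ x y, (subdivGraph f).Reachable (toSubdiv f x) (toSubdiv f y) := by
    intro x y
    obtain ⟨w⟩ := X.isTree.connected x y
    induction w with
    | nil => rfl
    | @cons a b _ h _ ih =>
      obtain ⟨u, -⟩ := (inSegment_right (f := f) a b).exists_walk h (hne a b h)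
      exact u.reachable.trans ih
  obtain ⟨z⟩ := X.isTree.connected.nonempty
  have hz : ∀ p, (subdivGraph f).Reachable (toSubdiv f z) p := by
    intro p
    rcases p.2 with ⟨x, hx⟩ | ⟨x, y, hxy, hp⟩
    · obtain rfl : p = toSubdiv f x := Subtype.ext hx
      exact hX z x
    · obtain ⟨u, -⟩ := hp.exists_walk hxy (hne x y hxy)
      exact (hX z x).trans u.reachable
  have : Nonempty (SubdivVertex f) := ⟨toSubdiv f z⟩
  exact ⟨fun p q ↦ (hz p).symm.trans (hz q)⟩

variable (f) in
/-- A rank function on the points of the subdivision which increases away from `z`. -/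
noncomputable def subdivRank (z : X.V) (p : Sym2 X.V × Y.V) : ℕ ×ₗ ℕ :=
  Sym2.lift ⟨fun a b ↦ toLex (X.graph.dist z a + X.graph.dist z b,
    X.graph.dist z a * Y.graph.dist p.2 (f b) + X.graph.dist z b * Y.graph.dist p.2 (f a)),
    fun _ _ ↦ congrArg toLex (Prod.ext (add_comm _ _) (add_comm _ _))⟩ p.1

lemma subdivRank_mk (z a b : X.V) (v : Y.V) : subdivRank f z (s(a, b), v) =
    toLex (X.graph.dist z a + X.graph.dist z b,
      X.graph.dist z a * Y.graph.dist v (f b) + X.graph.dist z b * Y.graph.dist v (f a)) :=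
  rfl

/-- On a segment directed away from `z`, the rank orders points by their distance to the initial
endpoint. -/
lemma InSegment.dist_le_of_subdivRank_le {z x y : X.V}
    (hz : X.graph.dist z y = X.graph.dist z x + 1) {p q : Sym2 X.V × Y.V}
    (hp : InSegment f x y p) (hq : InSegment f x y q)
    (h : subdivRank f z q ≤ subdivRank f z p) :
    Y.graph.dist (f x) q.2 ≤ Y.graph.dist (f x) p.2 := by
  have hpd := hp.dist_add_dist
  have hqd := hq.dist_add_dist
  obtain ⟨p₁, v⟩ := p
  obtain ⟨q₁, w⟩ := q
  simp only [InSegment, Prod.mk.injEq] at hp hq hpd hqd ⊢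
  rcases hp with ⟨rfl, rfl⟩ | ⟨rfl, rfl⟩ | ⟨rfl, -⟩ <;>
    rcases hq with ⟨rfl, rfl⟩ | ⟨rfl, rfl⟩ | ⟨rfl, -⟩ <;>
    simp only [subdivRank_mk, Prod.Lex.toLex_le_toLex, SimpleGraph.dist_self] at h ⊢ <;>
    try omega
  rw [hz, Y.graph.dist_comm (u := v) (v := f x), Y.graph.dist_comm (u := w) (v := f x)] at h
  rcases h with h | ⟨-, h⟩
  · omega
  · by_contra! hlt
    obtain ⟨k, hk⟩ := Nat.exists_eq_add_of_lt hlt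
    have : Y.graph.dist v (f y) = Y.graph.dist w (f y) + k + 1 := by omega
    rw [this, hk] at h
    nlinarith

lemma subdivGraph_isAcyclic (hne : ∀ x y, X.graph.Adj x y → f x ≠ f y) :
    (subdivGraph f).IsAcyclic := by
  obtain ⟨z⟩ := X.isTree.connected.nonempty
  refine SimpleGraph.isAcyclic_of_rank (fun p ↦ subdivRank f z p.1) ?_
  have key : ∀ p q : SubdivVertex f, (subdivGraph f).Adj p q →
      subdivRank f z q.1 ≤ subdivRank f z p.1 →
      ∃ x y, X.graph.Adj x y ∧ X.graph.dist z y = X.graph.dist z x + 1 ∧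
        (p.1.1 = s(y, y) ∨ p.1.1 = s(x, y)) ∧ InSegment f x y q.1 ∧
        Y.graph.dist (f x) q.1.2 < Y.graph.dist (f x) p.1.2 := by
    rintro p q ⟨hpq, x, y, hxy, hp, hq⟩ hle
    wlog hd : X.graph.dist z y = X.graph.dist z x + 1 generalizing x y
    · refine this y x hxy.symm hp.symm hq.symm ?_
      have := X.isTree.dist_eq_dist_add_one_of_adj z hxy
      omega
    have hlt : Y.graph.dist (f x) q.1.2 < Y.graph.dist (f x) p.1.2 :=
      (hp.dist_le_of_subdivRank_le hd hq hle).lt_of_ne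
        (Y.isTree.dist_ne_of_adj (f x) hpq).symm
    refine ⟨x, y, hxy, hd, ?_, hq, hlt⟩
    rcases hp with hp | hp | hp
    · simp [hp] at hlt
    · exact .inl (by rw [hp])
    · exact .inr hp.1
  intro p q₁ q₂ h₁ h₂ hr₁ hr₂
  obtain ⟨x₁, y₁, hxy₁, hd₁, hp₁, hq₁, hl₁⟩ := key p q₁ h₁ hr₁
  obtain ⟨x₂, y₂, hxy₂, hd₂, hp₂, hq₂, hl₂⟩ := key p q₂ h₂ hr₂
  have hy : y₁ = y₂ := by
    rcases hp₁ with hp₁ | hp₁ <;> rcases hp₂ with hp₂ | hp₂ <;> rw [hp₁] at hp₂ <;>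
      simp only [Sym2.eq_iff] at hp₂ <;> grind
  subst hy
  obtain rfl : x₁ = x₂ :=
    X.isTree.eq_of_adj_of_dist_lt (r := z) hxy₁.symm hxy₂.symm (by omega) (by omega)
  exact Subtype.ext <| hq₁.ext (hne _ _ hxy₁) hq₂ <|
    Y.isTree.eq_of_adj_of_dist_lt (r := f x₁) h₁.1 h₂.1 hl₁ hl₂

lemma InSegment.smul (hf : ∀ γ x, f (X.smul γ x) = Y.smul γ (f x)) (γ : G) {x y : X.V}
    {p : Sym2 X.V × Y.V} (hp : InSegment f x y p) :
    InSegment f (X.smul γ x) (X.smul γ y) (p.1.map (X.smul γ), Y.smul γ p.2) := by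
  rcases hp with rfl | rfl | ⟨h, hx, hy, hd⟩
  · exact .inl (by simp [hf])
  · exact .inr (.inl (by simp [hf]))
  · refine .inr (.inr ⟨by simp [h], ?_, ?_, ?_⟩)
    · simpa only [hf] using (Y.smul_injective γ).ne hx
    · simpa only [hf] using (Y.smul_injective γ).ne hy
    · simpa only [hf, dist_smul] using hd

/-- The action on the vertices of the subdivision. -/
def subdivSmul (hf : ∀ γ x, f (X.smul γ x) = Y.smul γ (f x)) (γ : G) (p : SubdivVertex f) :
    SubdivVertex f :=
  ⟨(p.1.1.map (X.smul γ), Y.smul γ p.1.2), by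
    rcases p.2 with ⟨x, hx⟩ | ⟨x, y, hxy, hp⟩
    · exact .inl ⟨X.smul γ x, by simp [hx, hf]⟩
    · exact .inr ⟨_, _, X.smul_adj γ hxy, hp.smul hf γ⟩⟩

/-- The subdivision of `X` along an equivariant map `f` which separates the endpoints of edges. -/
def subdivision (hf : ∀ γ x, f (X.smul γ x) = Y.smul γ (f x))
    (hne : ∀ x y, X.graph.Adj x y → f x ≠ f y) : GTree G where
  V := SubdivVertex f
  graph := subdivGraph f
  isTree := ⟨subdivGraph_connected hne, subdivGraph_isAcyclic hne⟩
  smul := subdivSmul hf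
  smul_one p := Subtype.ext <| Prod.ext
    ((congrArg (Sym2.map · p.1.1) (funext X.smul_one)).trans (congrFun Sym2.map_id p.1.1))
    (Y.smul_one _)
  smul_mul γ δ p := Subtype.ext <| Prod.ext
    ((congrArg (Sym2.map · p.1.1) (funext (X.smul_mul γ δ))).trans
      (Sym2.map_map (g := X.smul γ) (f := X.smul δ) p.1.1).symm)
    (Y.smul_mul _ _ _)
  smul_adj γ _ _ := fun ⟨h, _, _, hxy, hp, hq⟩ ↦
    ⟨Y.smul_adj γ h, _, _, X.smul_adj γ hxy, hp.smul hf γ, hq.smul hf γ⟩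
  no_inversions γ p q h := fun ⟨hpq, hqp⟩ ↦ Y.no_inversions γ p.1.2 q.1.2 h.1
    ⟨congrArg (fun r : SubdivVertex f ↦ r.1.2) hpq, congrArg (fun r : SubdivVertex f ↦ r.1.2) hqp⟩

lemma subdivision_isSubdivisionOf (hf : ∀ γ x, f (X.smul γ x) = Y.smul γ (f x))
    (hne : ∀ x y, X.graph.Adj x y → f x ≠ f y) :
    (subdivision hf hne).IsSubdivisionOf X := by
  have hinterior : ∀ {x y : X.V}, X.graph.Adj x y → ∀ {q : SubdivVertex f},
      InSegment f x y q.1 → q ≠ toSubdiv f x → q ≠ toSubdiv f y →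
      q ∉ Set.range (toSubdiv f) := by
    rintro x y hxy q hq hqx hqy ⟨w, hw⟩
    rcases hq.eq_toSubdiv hxy hw.symm with rfl | rfl
    · exact hqx hw.symm
    · exact hqy hw.symm
  refine ⟨toSubdiv f, toSubdiv_injective, fun γ x ↦ ?_, fun x y hxy ↦ ?_, fun v hv ↦ ?_⟩
  · exact Subtype.ext (Prod.ext rfl (hf γ x))
  · obtain ⟨w, hw, -, hs⟩ := (inSegment_left (f := f) x y).exists_path hxy (hne x y hxy)
    refine ⟨w, hw, ?_, fun q hq ↦ hinterior hxy (hs q hq)⟩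
    rw [Nat.pos_iff_ne_zero]
    exact fun h ↦ hxy.ne (toSubdiv_injective (SimpleGraph.Walk.eq_of_length_eq_zero h))
  · rcases v.2 with ⟨x, hx⟩ | ⟨x, y, hxy, hp⟩
    · exact absurd ⟨x, (Subtype.ext hx).symm⟩ hv
    · obtain ⟨w, hw, hv, hs⟩ := hp.exists_path hxy (hne x y hxy)
      exact ⟨x, y, hxy, w, hw, hv, fun q hq ↦ hinterior hxy (hs q hq)⟩

end Subdivision

end GTree

open GTree in
/-- Proposition 4.14: let `X` and `Y` be cocompact `G`-trees which define the
same partition of `G` into elliptic and hyperbolic elements.  Suppose that `X`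
is reduced and every vertex stabilizer of `X` fixes a vertex of `Y`.  Then,
after possibly subdividing `X`, there is an equivariant morphism `φ : X' → Y`
(a map of vertices sending edges to edges). -/
theorem exists_equivariant_morphism {G : Type u} [Group G] (X Y : GTree G)
    (hXc : X.Cocompact) (hYc : Y.Cocompact)
    (hpart : ∀ γ : G, X.Elliptic γ ↔ Y.Elliptic γ)
    (hred : X.Reduced)
    (hstab : ∀ x : X.V, ∃ y : Y.V, ∀ γ : G, X.smul γ x = x → Y.smul γ y = y) :
    ∃ X' : GTree G, X'.IsSubdivisionOf X ∧
      ∃ φ : X'.V → Y.V,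
        (∀ γ x, φ (X'.smul γ x) = Y.smul γ (φ x)) ∧
        ∀ x y, X'.graph.Adj x y → Y.graph.Adj (φ x) (φ y) := by
  obtain ⟨f, hf⟩ := exists_equivariant_map X Y hstab
  have hne : ∀ x y, X.graph.Adj x y → f x ≠ f y := fun _ _ h ↦
    ne_of_adj_of_equivariant X Y hpart hred hf h
  exact ⟨subdivision hf hne, subdivision_isSubdivisionOf hf hne, subdivHom f,
    fun _ _ ↦ rfl, fun _ _ h ↦ h.1⟩
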